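/- If n real polynomials P_1, ..., P_n of degree at most d are such that for every label vector (a_1,...,a_n) ∈ {0,1}^n there exist δ ∈ ℝ and β ∈ (0,1) with sgn(P_i(δ) + (1/β - 1)P_i(0)) = a_i for all i (where sgn(x) = 1 if x ≥ 0 and 0 otherwise), then 2^n ≤ (n² + n)d + n + 1. -/

import Mathlib

/-- sgn(x) = 1 if x ≥ 0 and 0 otherwise. -/
noncomputable def sgn01 (x : ℝ) : Fin 2 := if 0 ≤ x then 1 else 0

open Finset Polynomial Topology

/-- The strict sublevel set `{i | f i < t}` of a finite family of reals. -/
noncomputable def sublevelIndices {ι : Type*} [Fintype ι] (f : ι → ℝ) (t : ℝ) : Finset ι :=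
  {i | f i < t}

section Sublevel

variable {ι : Type*} [Fintype ι]

@[simp]
theorem mem_sublevelIndices {f : ι → ℝ} {t : ℝ} {i : ι} : i ∈ sublevelIndices f t ↔ f i < t := by
  simp [sublevelIndices]

theorem sublevelIndices_mono (f : ι → ℝ) {s t : ℝ} (h : s ≤ t) :
    sublevelIndices f s ⊆ sublevelIndices f t := fun i hi => by
  rw [mem_sublevelIndices] at *
  exact hi.trans_le h

/-- A nonempty sublevel set is determined by any of its maximizers. -/
theorem sublevelIndices_eq_of_common_max {f : ι → ℝ} {s t : ℝ} {i : ι}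
    (hs : i ∈ sublevelIndices f s) (hsmax : ∀ k ∈ sublevelIndices f s, f k ≤ f i)
    (ht : i ∈ sublevelIndices f t) (htmax : ∀ k ∈ sublevelIndices f t, f k ≤ f i) :
    sublevelIndices f s = sublevelIndices f t := by
  ext k
  constructor
  · intro hk
    exact mem_sublevelIndices.2 ((hsmax k hk).trans_lt (mem_sublevelIndices.1 ht))
  · intro hk
    exact mem_sublevelIndices.2 ((htmax k hk).trans_lt (mem_sublevelIndices.1 hs))

/-- The pair `(i, j)` witnesses that `A` is not a sublevel set of `f`: `i` maximizes `f` on `A`,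
and `j` is a `g`-minimal index outside `A` with `f j ≤ f i`. -/
structure IsObstruction (f g : ι → ℝ) (A : Finset ι) (i j : ι) : Prop where
  left_mem : i ∈ A
  le_left : ∀ k ∈ A, f k ≤ f i
  right_notMem : j ∉ A
  right_le : f j ≤ f i
  min_right : ∀ k ∉ A, f k ≤ f i → g j ≤ g k

theorem exists_isObstruction {f : ι → ℝ} (g : ι → ℝ) {A : Finset ι} (hA : A.Nonempty)
    (h : ∀ t, A ≠ sublevelIndices f t) : ∃ i j, IsObstruction f g A i j := by
  classical
  obtain ⟨i, hi, hmax⟩ := A.exists_max_image f hA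
  have hne : ({k | k ∉ A ∧ f k ≤ f i} : Finset ι).Nonempty := by
    by_contra hempty
    have hgt : ∀ k ∉ A, f i < f k := fun k hk => by
      by_contra! hle
      exact hempty ⟨k, by simp [hk, hle]⟩
    by_cases hAc : (Aᶜ).Nonempty
    · obtain ⟨j, hj, hmin⟩ := Aᶜ.exists_min_image f hAc
      refine h (f j) (Finset.ext fun k => ?_)
      rw [mem_sublevelIndices]
      refine ⟨fun hk => (hmax k hk).trans_lt (hgt j (mem_compl.1 hj)), fun hk => ?_⟩
      by_contra hkA
      exact (hmin k (mem_compl.2 hkA)).not_gt hk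
    · refine h (f i + 1) (Finset.ext fun k => ?_)
      have hk : k ∈ A := by
        by_contra hkA
        exact hAc ⟨k, mem_compl.2 hkA⟩
      rw [mem_sublevelIndices]
      exact ⟨fun _ => by linarith [hmax k hk], fun _ => hk⟩
  obtain ⟨j, hj, hmin⟩ := exists_min_image _ g hne
  simp only [mem_filter, mem_univ, true_and] at hj hmin
  exact ⟨i, j, hi, hmax, hj.1, hj.2, fun k hk hle => hmin k ⟨hk, hle⟩⟩

/-- Distinct sublevel sets of `g` cannot have the same obstruction for `f`. -/
theorem IsObstruction.sublevelIndices_eq {f g : ι → ℝ} {s t : ℝ} {i j : ι}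
    (hs : IsObstruction f g (sublevelIndices g s) i j)
    (ht : IsObstruction f g (sublevelIndices g t) i j) :
    sublevelIndices g s = sublevelIndices g t := by
  wlog hst : s ≤ t generalizing s t
  · exact (this ht hs (le_of_not_ge hst)).symm
  refine (sublevelIndices_mono g hst).antisymm fun k hk => ?_
  by_contra hks
  have h₁ := hs.min_right k hks (ht.le_left k hk)
  have h₂ := ht.right_notMem
  rw [mem_sublevelIndices] at hk h₂
  linarith

/-- A finite collection of nonempty sets of the form `{i | T i (x) < t}`, for polynomials `T i` of
degree at most `d`, has at most `m + m (m - 1) d` elements, where `m` is the number of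
polynomials. -/
theorem card_sublevelIndices_eval_le (T : ι → ℝ[X]) {d : ℕ} (hd : ∀ i, (T i).natDegree ≤ d)
    (F : Finset (Finset ι)) (hne : ∀ A ∈ F, A.Nonempty)
    (hF : ∀ A ∈ F, ∃ x t, A = sublevelIndices (fun i => (T i).eval x) t) :
    #F ≤ Fintype.card ι + (Fintype.card ι * Fintype.card ι - Fintype.card ι) * d := by
  classical
  rcases F.eq_empty_or_nonempty with rfl | hFne
  · simp
  let R (x : ℝ) (A : Finset ι) : Prop := ∃ t, A = sublevelIndices (fun i => (T i).eval x) t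
  choose! x hx using hF
  let D := F.image x
  have hDne : D.Nonempty := hFne.image x
  let x₀ := D.min' hDne
  rw [← card_filter_add_card_filter_not (s := F) (R x₀)]
  refine add_le_add ?_ ?_
  · have hmax : ∀ A ∈ F.filter (R x₀), ∃ i ∈ A, ∀ k ∈ A, (T k).eval x₀ ≤ (T i).eval x₀ :=
      fun A hA => A.exists_max_image _ (hne A (mem_filter.1 hA).1)
    have : Nonempty ι := let ⟨A, hA⟩ := hFne; ⟨(hne A hA).choose⟩
    choose! i hi using hmax
    rw [← card_univ]
    refine card_le_card_of_injOn i (fun _ _ => by simp) fun A hA B hB hAB => ?_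
    have hA' := hi A hA
    have hB' := hi B hB
    obtain ⟨s, rfl⟩ := (mem_filter.1 hA).2
    obtain ⟨t, rfl⟩ := (mem_filter.1 hB).2
    rw [← hAB] at hB'
    exact sublevelIndices_eq_of_common_max hA'.1 hA'.2 hB'.1 hB'.2
  · let Q : Finset (Σ _ : ι × ι, ℝ) :=
      (univ : Finset ι).offDiag.sigma fun p => (T p.1 - T p.2).roots.toFinset
    have hQ : #Q ≤ (Fintype.card ι * Fintype.card ι - Fintype.card ι) * d := by
      rw [card_sigma, ← card_univ, ← offDiag_card]
      refine sum_le_card_nsmul _ _ _ fun p _ => ?_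
      exact (Multiset.toFinset_card_le _).trans ((card_roots' _).trans
        ((natDegree_sub_le _ _).trans (max_le (hd _) (hd _))))
    refine le_trans ?_ hQ
    have key : ∀ A ∈ F.filter (fun A => ¬ R x₀ A), ∃ q ∈ Q, ∃ y ∈ D, ∃ z ∈ D,
        (∀ w ∈ D, w < z → w ≤ y) ∧ y ≤ q.2 ∧ q.2 < z ∧ R z A ∧
        IsObstruction (fun i => (T i).eval y) (fun i => (T i).eval z) A q.1.1 q.1.2 := by
      intro A hA
      obtain ⟨hAF, hA₀⟩ := mem_filter.1 hA
      have hZ : (D.filter (R · A)).Nonempty :=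
        ⟨x A, mem_filter.2 ⟨mem_image_of_mem x hAF, hx A hAF⟩⟩
      let z := (D.filter (R · A)).min' hZ
      obtain ⟨hzD, hzA⟩ := mem_filter.1 (min'_mem _ hZ)
      have hx₀z : x₀ < z := lt_of_le_of_ne (min'_le _ _ hzD) fun h => hA₀ (h ▸ hzA)
      have hY : (D.filter (· < z)).Nonempty := ⟨x₀, mem_filter.2 ⟨min'_mem _ _, hx₀z⟩⟩
      let y := (D.filter (· < z)).max' hY
      obtain ⟨hyD, hyz⟩ := mem_filter.1 (max'_mem _ hY)
      have hyA : ¬ R y A := fun h =>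
        (min'_le (D.filter (R · A)) y (mem_filter.2 ⟨hyD, h⟩)).not_gt hyz
      obtain ⟨i, j, hij⟩ := exists_isObstruction (f := fun i => (T i).eval y)
        (fun i => (T i).eval z) (hne A hAF) (not_exists.1 hyA)
      have hlt : (T i).eval z < (T j).eval z := by
        obtain ⟨t, ht⟩ := hzA
        have hi := hij.left_mem
        have hj := hij.right_notMem
        rw [ht, mem_sublevelIndices] at hi hj
        exact hi.trans_le (not_lt.1 hj)
      obtain ⟨r, hr, hr₀⟩ := intermediate_value_Ico' hyz.le
        (T i - T j).continuous.continuousOn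
        (show (0 : ℝ) ∈ Set.Ioc _ _ by
          have := hij.right_le
          simp only [eval_sub, Set.mem_Ioc]
          constructor <;> linarith)
      have hTne : T i - T j ≠ 0 := fun h => by
        rw [sub_eq_zero.1 h] at hlt
        exact lt_irrefl _ hlt
      have hne' : i ≠ j := fun h => hij.right_notMem (h ▸ hij.left_mem)
      refine ⟨⟨(i, j), r⟩, ?_, y, hyD, z, hzD, ?_, hr.1, hr.2, hzA, hij⟩
      · simp only [Q, mem_sigma, mem_offDiag, mem_univ, true_and, Multiset.mem_toFinset]
        exact ⟨hne', (mem_roots hTne).2 hr₀⟩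
      · exact fun w hw hwz => le_max' _ _ (mem_filter.2 ⟨hw, hwz⟩)
    choose q hqQ hq using key
    refine card_le_card_of_injOn (fun A => if hA : A ∈ F.filter (fun A => ¬ R x₀ A) then q A hA
      else ⟨((hne _ hFne.choose_spec).choose, (hne _ hFne.choose_spec).choose), 0⟩) ?_ ?_
    · intro A hA
      simp only [mem_coe] at hA ⊢
      rw [dif_pos hA]
      exact hqQ A hA
    · intro A hA B hB hAB
      simp only [mem_coe] at hA hB
      simp only [dif_pos hA, dif_pos hB] at hAB
      obtain ⟨y, hy, z, hz, hyz, hyr, hrz, ⟨s, hs⟩, hobsA⟩ := hq A hA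
      obtain ⟨y', hy', z', hz', hyz', hyr', hrz', ⟨t, ht⟩, hobsB⟩ := hq B hB
      rw [← hAB] at hyr' hrz' hobsB
      have hyy : y = y' :=
        le_antisymm (hyz' y hy (hyr.trans_lt hrz')) (hyz y' hy' (hyr'.trans_lt hrz))
      have hzz : z = z' := by
        apply le_antisymm
        · by_contra! h
          exact ((hyz z' hz' h).trans hyr).not_gt hrz'
        · by_contra! h
          exact ((hyz' z hz h).trans hyr').not_gt hrz
      subst hyy hzz hs ht
      exact hobsA.sublevelIndices_eq hobsB

end Sublevel

/-- if all 2^n label vectors are realized by sign vectors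
(sgn(P_i(δ) + (1/β − 1)P_i(0)))_i, then 2^n ≤ (n² + n)d + n + 1. -/
theorem stmt2 (n d : ℕ) (P : Fin n → Polynomial ℝ)
    (hdeg : ∀ i, (P i).natDegree ≤ d)
    (hshatter : ∀ a : Fin n → Fin 2, ∃ δ : ℝ, ∃ β ∈ Set.Ioo (0:ℝ) 1,
      ∀ i, sgn01 ((P i).eval δ + (1/β - 1) * (P i).eval 0) = a i) :
    2^n ≤ (n^2 + n) * d + n + 1 := by
  classical
  choose δ β hβ hsgn using hshatter
  let t (a : Fin n → Fin 2) : ℝ := 1 / β a - 1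
  have ht : ∀ a, 0 < t a := fun a => sub_pos.2 ((one_lt_div (hβ a).1).2 (hβ a).2)
  -- Perturbing the constants `P i (0)` makes them nonzero and all sign conditions strict.
  obtain ⟨η, hη, hc, hneg⟩ : ∃ η : ℝ, 0 < η ∧ (∀ i, (P i).eval 0 + η ≠ 0) ∧
      ∀ a i, (P i).eval (δ a) + t a * (P i).eval 0 < 0 →
        (P i).eval (δ a) + t a * ((P i).eval 0 + η) < 0 := by
    have h₁ : ∀ᶠ η : ℝ in 𝓝[>] 0, ∀ i, (P i).eval 0 + η ≠ 0 := by
      refine Filter.eventually_all.2 fun i => ?_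
      by_cases h : (P i).eval 0 = 0
      · filter_upwards [self_mem_nhdsWithin] with η hη
        rw [h, zero_add]
        exact ne_of_gt hη
      · refine Filter.Eventually.filter_mono nhdsWithin_le_nhds ?_
        exact ContinuousAt.eventually_ne (by fun_prop) (by simpa using h)
    have h₂ : ∀ᶠ η : ℝ in 𝓝[>] 0, ∀ a i, (P i).eval (δ a) + t a * (P i).eval 0 < 0 →
        (P i).eval (δ a) + t a * ((P i).eval 0 + η) < 0 := by
      refine Filter.eventually_all.2 fun a => Filter.eventually_all.2 fun i => ?_
      refine Filter.eventually_imp_distrib_left.2 fun h => ?_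
      refine Filter.Eventually.filter_mono nhdsWithin_le_nhds ?_
      exact ContinuousAt.eventually_lt (by fun_prop) continuousAt_const (by simpa using h)
    obtain ⟨η, hη⟩ := ((Filter.Eventually.and self_mem_nhdsWithin (h₁.and h₂)) :
      ∀ᶠ η : ℝ in 𝓝[>] 0, η ∈ Set.Ioi 0 ∧ _).exists
    exact ⟨η, hη.1, hη.2.1, hη.2.2⟩
  have hzero : ∀ a i, a i = 0 → (P i).eval (δ a) + t a * ((P i).eval 0 + η) < 0 := by
    intro a i hai
    refine hneg a i (lt_of_not_ge fun h => ?_)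
    have := hsgn a i
    rw [hai, sgn01, if_pos h] at this
    exact one_ne_zero this
  have hone : ∀ a i, a i ≠ 0 → 0 < (P i).eval (δ a) + t a * ((P i).eval 0 + η) := by
    intro a i hai
    have h : 0 ≤ (P i).eval (δ a) + t a * (P i).eval 0 := by
      by_contra h
      have := hsgn a i
      rw [sgn01, if_neg h] at this
      exact hai this.symm
    linarith [mul_pos (ht a) hη]
  let T : Option (Fin n) → ℝ[X] := fun o => o.elim 0 fun i => C (-((P i).eval 0 + η)⁻¹) * P i
  have hT : ∀ o, (T o).natDegree ≤ d := by
    rintro (_ | i)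
    · simp [T]
    · exact (natDegree_C_mul_le _ _).trans (hdeg i)
  let A (a : Fin n → Fin 2) := sublevelIndices (fun o => (T o).eval (δ a)) (t a)
  have hmem : ∀ a i, some i ∈ A a ↔ (a i ≠ 0 ↔ 0 < (P i).eval 0 + η) := by
    intro a i
    have h₀ := hzero a i
    have h₁ := hone a i
    have hev : (T (some i)).eval (δ a) = -(P i).eval (δ a) / ((P i).eval 0 + η) := by
      simp only [T, Option.elim, eval_mul, eval_C]
      ring
    rw [mem_sublevelIndices, hev]
    rcases lt_or_gt_of_ne (hc i) with hci | hci
    · rw [div_lt_iff_of_neg hci]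
      by_cases hai : a i = 0
      · simp only [hai, ne_eq, not_true, hci.not_gt, iff_self, iff_true]
        linarith [h₀ hai]
      · simp only [hai, ne_eq, not_false_eq_true, hci.not_gt, not_true, iff_false]
        linarith [h₁ hai]
    · rw [div_lt_iff₀ hci]
      by_cases hai : a i = 0
      · simp only [hai, ne_eq, not_true, hci, iff_true, iff_false]
        linarith [h₀ hai]
      · simp only [hai, ne_eq, not_false_eq_true, hci, iff_true]
        linarith [h₁ hai]
  have hinj : Function.Injective A := by
    intro a b hab
    funext i
    have h := hmem a i
    rw [hab, hmem b i] at h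
    have : a i = 0 ↔ b i = 0 := by tauto
    omega
  have hcard := card_sublevelIndices_eval_le T hT (univ.image A)
    (by
      simp only [mem_image, mem_univ, true_and, forall_exists_index, forall_apply_eq_imp_iff]
      exact fun a => ⟨none, mem_sublevelIndices.2 (by simpa [T] using ht a)⟩)
    (by
      simp only [mem_image, mem_univ, true_and, forall_exists_index, forall_apply_eq_imp_iff]
      exact fun a => ⟨δ a, t a, rfl⟩)
  rw [card_image_of_injective _ hinj] at hcard
  simp only [card_univ, Fintype.card_fun, Fintype.card_fin, Fintype.card_option] at hcard
  have hsub : (n + 1) * (n + 1) - (n + 1) = n ^ 2 + n := by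
    rw [Nat.sub_eq_iff_eq_add (by nlinarith)]
    ring
  rw [hsub] at hcard
  linarith
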